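/- Let X = (X_n)_{n∈ℕ} be a random sequence of binary trees with, almost surely, |X_n| = n, X_n ⊂ X_{n+1} for all n, and ∪_n X_n = V. If X is locally exchangeable, i.e. for every u ∈ V the local increment process Y(u) is an exchangeable sequence, then there exists a random Borel probability measure M on V_∞ such that, with probability one, t(X_n, u) → M(B_u) as n → ∞ for every u ∈ V, and moreover M(B_u) > 0 for all u ∈ V with probability one (M has full support almost surely). -/

import Mathlib

open MeasureTheory ProbabilityTheory Filter Topology
open scoped ENNReal NNReal

namespace DMTCS

/-- `V = {0,1}^*`: the set of finite binary words. -/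
abbrev Word : Type := List Bool

/-- `V_∞ = {0,1}^ℕ`: infinite binary sequences, with the product (Borel) σ-field. -/
abbrev BSeq : Type := ℕ → Bool

/-- The prefix of length `k` of an infinite sequence. -/
def prefixSeq (v : BSeq) (k : ℕ) : Word := List.ofFn (fun i : Fin k => v i)

/-- The cylinder set `B_u = {v ∈ V_∞ : u is a prefix of v}`. -/
def cyl (u : Word) : Set BSeq := {v | prefixSeq v u.length = u}

/-- A (finite) binary tree: a prefix-stable finite set of words. -/
def IsBinTree (x : Finset Word) : Prop := ∀ v ∈ x, v ≠ [] → v.dropLast ∈ x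

/-- The number of nodes of the subtree of `x` rooted at `u`, i.e. `|{v : u+v ∈ x}|`. -/
def subCard (x : Finset Word) (u : Word) : ℕ := (x.filter (fun w => u <+: w)).card

/-- The relative subtree size function `t(x,u)`. -/
noncomputable def stf (x : Finset Word) (u : Word) : ℝ := (subCard x u : ℝ) / (x.card : ℝ)

instance : MeasurableSpace (Finset Word) := ⊤

/-- Entry time of node `w` into the increasing tree sequence `x`. -/
noncomputable def entryTime (x : ℕ → Finset Word) (w : Word) : ℕ := sInf {n | w ∈ x n}

/-- The local increment process at `u`: `locInc x u n` is `1` if the right subtree of `u`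
receives a node at time `τ_u + n + 1`, `-1` if the left subtree does, and `0` otherwise. -/
noncomputable def locInc (x : ℕ → Finset Word) (u : Word) (n : ℕ) : ℤ :=
  if subCard (x (entryTime x u + n + 1)) (u ++ [true])
       > subCard (x (entryTime x u + n)) (u ++ [true]) then 1
  else if subCard (x (entryTime x u + n + 1)) (u ++ [false])
       > subCard (x (entryTime x u + n)) (u ++ [false]) then -1
  else 0

/-- A sequence of random variables is exchangeable if its joint law is invariant under
every permutation of finitely many coordinates. -/
def Exchangeable {Ω : Type*} [MeasurableSpace Ω] (P : Measure Ω) (Y : ℕ → Ω → ℤ) : Prop :=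
  ∀ π : Equiv.Perm ℕ, {n | π n ≠ n}.Finite →
    Measure.map (fun ω => fun n => Y (π n) ω) P = Measure.map (fun ω => fun n => Y n ω) P

lemma swap_finite (a b : ℕ) : {n | Equiv.swap a b n ≠ n}.Finite := by
  apply Set.Finite.subset (Set.toFinite {a, b})
  intro n hn
  by_contra h
  simp only [Set.mem_insert_iff, Set.mem_singleton_iff, not_or] at h
  exact hn (Equiv.swap_apply_of_ne_of_ne h.1 h.2)

/-- Invariance of probabilities of events under swaps. -/
lemma exch_swap {Ω : Type*} [MeasurableSpace Ω] {P : Measure Ω}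
    {Y : ℕ → Ω → ℤ} (hY : ∀ n, Measurable (Y n)) (hex : Exchangeable P Y) (a b : ℕ)
    {s : Set (ℕ → ℤ)} (hs : MeasurableSet s) :
    P {ω | (fun n => Y (Equiv.swap a b n) ω) ∈ s} = P {ω | (fun n => Y n ω) ∈ s} := by
  have h := hex (Equiv.swap a b) (swap_finite a b)
  have h1 := congrArg (fun μ => μ s) h
  beta_reduce at h1
  rw [Measure.map_apply (measurable_pi_lambda _ (fun n => hY _)) hs,
    Measure.map_apply (measurable_pi_lambda _ (fun n => hY _)) hs] at h1
  exact h1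

/-- Indicator of the value `c`. -/
noncomputable def ind (c : ℤ) (z : ℤ) : ℝ := if z = c then 1 else 0

lemma ind_nonneg (c z : ℤ) : 0 ≤ ind c z := by unfold ind; split_ifs <;> simp
lemma ind_le_one (c z : ℤ) : ind c z ≤ 1 := by unfold ind; split_ifs <;> simp
lemma ind_meas (c : ℤ) : Measurable (ind c) := measurable_from_top

noncomputable def cnt (c : ℤ) (y : ℕ → ℤ) (n : ℕ) : ℝ := ∑ i ∈ Finset.range n, ind c (y i)

lemma cnt_nonneg (c : ℤ) (y : ℕ → ℤ) (n : ℕ) : 0 ≤ cnt c y n :=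
  Finset.sum_nonneg fun _ _ => ind_nonneg _ _

lemma cnt_le (c : ℤ) (y : ℕ → ℤ) (n : ℕ) : cnt c y n ≤ n := by
  unfold cnt
  calc _ ≤ ∑ i ∈ Finset.range n, (1 : ℝ) := Finset.sum_le_sum fun _ _ => ind_le_one _ _
    _ = n := by simp

lemma cnt_mono (c : ℤ) (y : ℕ → ℤ) : Monotone (cnt c y) := by
  apply monotone_nat_of_le_succ
  intro n
  unfold cnt
  rw [Finset.sum_range_succ]
  linarith [ind_nonneg c (y n)]

lemma cnt_meas (c : ℤ) (n : ℕ) : Measurable (fun y => cnt c y n) := by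
  unfold cnt
  exact Finset.measurable_sum _ fun i _ => (ind_meas c).comp (measurable_pi_apply i)

lemma cnt_div_nonneg (c : ℤ) (y : ℕ → ℤ) (n : ℕ) : 0 ≤ cnt c y n / n :=
  div_nonneg (cnt_nonneg _ _ _) (Nat.cast_nonneg _)

lemma cnt_div_le (c : ℤ) (y : ℕ → ℤ) (n : ℕ) : cnt c y n / n ≤ 1 :=
  div_le_one_of_le₀ (cnt_le _ _ _) (Nat.cast_nonneg _)

section L2
variable {Ω : Type*} [MeasurableSpace Ω] {P : Measure Ω} [IsProbabilityMeasure P]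
    {Y : ℕ → Ω → ℤ}

lemma pair_int (hY : ∀ n, Measurable (Y n)) (c : ℤ) (i j : ℕ) :
    Integrable (fun ω => ind c (Y i ω) * ind c (Y j ω)) P := by
  refine Integrable.of_bound (C := 1) ?_ (ae_of_all _ fun ω => ?_)
  · exact (((ind_meas c).comp (hY i)).mul ((ind_meas c).comp (hY j))).aestronglyMeasurable
  · rw [Real.norm_of_nonneg (mul_nonneg (ind_nonneg _ _) (ind_nonneg _ _))]
    exact mul_le_one₀ (ind_le_one _ _) (ind_nonneg _ _) (ind_le_one _ _)

lemma pair_swap (hY : ∀ n, Measurable (Y n)) (hex : Exchangeable P Y) (c : ℤ) (a b i j : ℕ) :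
    ∫ ω, ind c (Y (Equiv.swap a b i) ω) * ind c (Y (Equiv.swap a b j) ω) ∂P
      = ∫ ω, ind c (Y i ω) * ind c (Y j ω) ∂P := by
  have h := hex (Equiv.swap a b) (swap_finite a b)
  have m : Measurable (fun y : ℕ → ℤ => ind c (y i) * ind c (y j)) :=
    ((ind_meas c).comp (measurable_pi_apply i)).mul ((ind_meas c).comp (measurable_pi_apply j))
  have h1 := congrArg (fun μ => ∫ y, ind c (y i) * ind c (y j) ∂μ) h
  beta_reduce at h1
  rw [integral_map (measurable_pi_lambda _ (fun n => hY _)).aemeasurable m.aestronglyMeasurable,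
    integral_map (measurable_pi_lambda _ (fun n => hY _)).aemeasurable m.aestronglyMeasurable] at h1
  exact h1

lemma pair_eq (hY : ∀ n, Measurable (Y n)) (hex : Exchangeable P Y) (c : ℤ) (i j : ℕ) :
    ∫ ω, ind c (Y i ω) * ind c (Y j ω) ∂P =
      (∫ ω, ind c (Y 0 ω) * ind c (Y 1 ω) ∂P) +
      (if i = j then (∫ ω, ind c (Y 0 ω) * ind c (Y 0 ω) ∂P)
        - (∫ ω, ind c (Y 0 ω) * ind c (Y 1 ω) ∂P) else 0) := by
  by_cases hij : i = j
  · subst hij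
    have := pair_swap hY hex c 0 i i i
    simp only [Equiv.swap_apply_right] at this
    simp [this]
  · have h1 := pair_swap hY hex c 0 i i j
    rw [Equiv.swap_apply_right] at h1
    have hne : Equiv.swap 0 i j ≠ 0 := by
      intro h
      rw [Equiv.swap_apply_eq_iff, Equiv.swap_apply_left] at h
      exact hij h.symm
    have h2 := pair_swap hY hex c 1 (Equiv.swap 0 i j) 0 (Equiv.swap 0 i j)
    rw [Equiv.swap_apply_right, Equiv.swap_apply_of_ne_of_ne (by norm_num) hne.symm] at h2
    simp [hij, h2, h1]

lemma cnt_pair (hY : ∀ n, Measurable (Y n)) (hex : Exchangeable P Y) (c : ℤ) {n m : ℕ}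
    (hnm : n ≤ m) :
    ∫ ω, cnt c (fun k => Y k ω) n * cnt c (fun k => Y k ω) m ∂P =
      n * m * (∫ ω, ind c (Y 0 ω) * ind c (Y 1 ω) ∂P) +
      n * ((∫ ω, ind c (Y 0 ω) * ind c (Y 0 ω) ∂P)
        - (∫ ω, ind c (Y 0 ω) * ind c (Y 1 ω) ∂P)) := by
  unfold cnt
  simp_rw [Finset.sum_mul_sum]
  rw [integral_finsetSum _ fun i _ => integrable_finsetSum _ fun j _ => pair_int hY c i j]
  simp_rw [integral_finsetSum (Finset.range m) fun j _ => pair_int hY c _ j]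
  rw [Finset.sum_congr rfl fun i _ => Finset.sum_congr rfl fun j _ => pair_eq hY hex c i j]
  generalize (∫ ω, ind c (Y 0 ω) * ind c (Y 0 ω) ∂P) = a
  generalize (∫ ω, ind c (Y 0 ω) * ind c (Y 1 ω) ∂P) = b
  have h1 : ∀ i ∈ Finset.range n, (∑ j ∈ Finset.range m, (b + if i = j then a - b else 0))
      = m * b + (a - b) := by
    intro i hi
    rw [Finset.sum_add_distrib, Finset.sum_ite_eq, if_pos]
    · simp
    · simp at hi ⊢
      omega
  rw [Finset.sum_congr rfl h1]
  simp
  ring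

lemma cnt_int (hY : ∀ n, Measurable (Y n)) (c : ℤ) (n m : ℕ) :
    Integrable (fun ω => cnt c (fun k => Y k ω) n * cnt c (fun k => Y k ω) m) P := by
  unfold cnt
  simp_rw [Finset.sum_mul_sum]
  exact integrable_finsetSum _ fun i _ => integrable_finsetSum _ fun j _ => pair_int hY c i j

lemma sq_expand (a b n m : ℝ) : (a / n - b / m) ^ 2 =
    (a * a) * (1 / n ^ 2) + (b * b) * (1 / m ^ 2) - (a * b) * (2 * (1 / n * (1 / m))) := by
  ring

lemma cnt_sq_int (hY : ∀ n, Measurable (Y n)) (c : ℤ) (n m : ℕ) :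
    Integrable (fun ω => (cnt c (fun k => Y k ω) n / n - cnt c (fun k => Y k ω) m / m) ^ 2) P := by
  simp_rw [sq_expand]
  exact (((cnt_int hY c n n).mul_const _).add ((cnt_int hY c m m).mul_const _)).sub
    ((cnt_int hY c n m).mul_const _)

lemma cnt_sq (hY : ∀ n, Measurable (Y n)) (hex : Exchangeable P Y) (c : ℤ) {n m : ℕ}
    (hn : 0 < n) (hnm : n ≤ m) :
    ∫ ω, (cnt c (fun k => Y k ω) n / n - cnt c (fun k => Y k ω) m / m) ^ 2 ∂P ≤
      1 / (n : ℝ) - 1 / m := by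
  simp_rw [sq_expand]
  rw [integral_sub ?_ ((cnt_int hY c n m).mul_const _), integral_add
    ((cnt_int hY c n n).mul_const _) ((cnt_int hY c m m).mul_const _)]
  swap
  · exact ((cnt_int hY c n n).mul_const _).add ((cnt_int hY c m m).mul_const _)
  simp_rw [integral_mul_const]
  rw [cnt_pair hY hex c le_rfl, cnt_pair hY hex c le_rfl, cnt_pair hY hex c hnm]
  set a := ∫ ω, ind c (Y 0 ω) * ind c (Y 0 ω) ∂P
  set b := ∫ ω, ind c (Y 0 ω) * ind c (Y 1 ω) ∂P with hb
  have hb0 : 0 ≤ b := integral_nonneg fun ω => mul_nonneg (ind_nonneg _ _) (ind_nonneg _ _)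
  have ha1 : a ≤ 1 := by
    calc a ≤ ∫ ω, (1 : ℝ) ∂P := by
          apply integral_mono (pair_int hY c 0 0) (integrable_const _)
          intro ω
          exact mul_le_one₀ (ind_le_one _ _) (ind_nonneg _ _) (ind_le_one _ _)
      _ = 1 := by simp
  have hn' : (0 : ℝ) < n := by exact_mod_cast hn
  have hnm' : (n : ℝ) ≤ m := by exact_mod_cast hnm
  have hm' : (0 : ℝ) < m := hn'.trans_le hnm'
  have h1 : (0 : ℝ) ≤ 1 / (n : ℝ) - 1 / m := sub_nonneg.2 (one_div_le_one_div_of_le hn' hnm')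
  have e : (↑n * ↑n * b + ↑n * (a - b)) * (1 / (n : ℝ) ^ 2) +
      (↑m * ↑m * b + ↑m * (a - b)) * (1 / (m : ℝ) ^ 2) -
      (↑n * ↑m * b + ↑n * (a - b)) * (2 * (1 / (n : ℝ) * (1 / m)))
      = (a - b) * (1 / (n : ℝ) - 1 / m) := by
    field_simp
    ring
  rw [e]
  nlinarith

lemma cube_bound (k : ℕ) : 1 / (((k + 1) ^ 3 : ℕ) : ℝ) - 1 / (((k + 1 + 1) ^ 3 : ℕ) : ℝ)
    ≤ 7 * (1 / ((k + 1 : ℕ) : ℝ) ^ 2) ^ 2 := by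
  push_cast
  have hx : (1 : ℝ) ≤ (k : ℝ) + 1 := by
    have : (0 : ℝ) ≤ k := Nat.cast_nonneg k
    linarith
  generalize (k : ℝ) + 1 = x at *
  have h0 : 0 < x := by linarith
  rw [div_sub_div _ _ (by positivity) (by positivity), div_pow, ← mul_div_assoc,
    div_le_div_iff₀ (by positivity) (by positivity)]
  have h2 : (1 * (x + 1) ^ 3 - x ^ 3 * 1) ≤ 7 * x ^ 2 := by nlinarith
  have h3 : x ^ 3 ≤ (x + 1) ^ 3 := by gcongr; linarith
  calc _ ≤ (7 * x ^ 2) * (x ^ 2) ^ 2 := by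
        rw [← pow_mul]; simp only [one_pow, one_mul] at *; gcongr
    _ = 7 * (x ^ 3 * x ^ 3) := by ring
    _ ≤ _ := by simp only [one_pow, mul_one]; gcongr

lemma ae_cube (hY : ∀ n, Measurable (Y n)) (hex : Exchangeable P Y) (c : ℤ) :
    ∀ᵐ ω ∂P, ∃ l : ℝ, Tendsto (fun k : ℕ => cnt c (fun i => Y i ω) ((k + 1) ^ 3) /
      (((k + 1) ^ 3 : ℕ) : ℝ)) atTop (𝓝 l) := by
  set A : ℕ → Ω → ℝ := fun k ω => cnt c (fun i => Y i ω) ((k + 1) ^ 3) /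
      (((k + 1) ^ 3 : ℕ) : ℝ) with hA
  have hYm : Measurable (fun ω => fun i => Y i ω) := measurable_pi_lambda _ hY
  have hAm : ∀ k, Measurable (A k) := fun k => ((cnt_meas c _).comp hYm).div_const _
  have hsum : ∑' k, ∫⁻ ω, ENNReal.ofReal |A k ω - A (k + 1) ω| ∂P ≠ ∞ := by
    have hb : ∀ k, ∫⁻ ω, ENNReal.ofReal |A k ω - A (k + 1) ω| ∂P ≤
        ENNReal.ofReal (4 * (1 / ((k + 1 : ℕ) : ℝ) ^ 2)) := by
      intro k
      set e : ℝ := 1 / ((k + 1 : ℕ) : ℝ) ^ 2 with he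
      have he0 : 0 < e := by positivity
      have hsq : ∫ ω, (A k ω - A (k + 1) ω) ^ 2 ∂P ≤ 7 * e ^ 2 :=
        (cnt_sq hY hex c (n := (k + 1) ^ 3) (m := (k + 1 + 1) ^ 3) (by positivity)
          (Nat.pow_le_pow_left (by omega) 3)).trans (cube_bound k)
      have hi : Integrable (fun ω => (A k ω - A (k + 1) ω) ^ 2) P := cnt_sq_int hY c _ _
      have hi2 : Integrable (fun ω => (e + (A k ω - A (k + 1) ω) ^ 2 * e⁻¹) * (1 / 2)) P :=
        ((integrable_const e).add (hi.mul_const _)).mul_const _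
      calc _ ≤ ∫⁻ ω, ENNReal.ofReal ((e + (A k ω - A (k + 1) ω) ^ 2 * e⁻¹) * (1 / 2)) ∂P := by
            apply lintegral_mono
            intro ω
            apply ENNReal.ofReal_le_ofReal
            rw [← sq_abs]
            generalize |A k ω - A (k + 1) ω| = d
            have : 0 ≤ (e - d) ^ 2 * e⁻¹ := by positivity
            have h3 : (e - d) ^ 2 * e⁻¹ = e - 2 * d + d ^ 2 * e⁻¹ := by field_simp; ring
            linarith
        _ = ENNReal.ofReal (∫ ω, (e + (A k ω - A (k + 1) ω) ^ 2 * e⁻¹) * (1 / 2) ∂P) := by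
            rw [ofReal_integral_eq_lintegral_ofReal hi2]
            exact ae_of_all _ fun ω => by positivity
        _ ≤ _ := by
            apply ENNReal.ofReal_le_ofReal
            rw [integral_mul_const, integral_add (integrable_const e) (hi.mul_const _),
              integral_mul_const]
            simp only [integral_const, probReal_univ, smul_eq_mul, one_mul]
            have : (∫ ω, (A k ω - A (k + 1) ω) ^ 2 ∂P) * e⁻¹ ≤ 7 * e ^ 2 * e⁻¹ := by gcongr
            have h3 : 7 * e ^ 2 * e⁻¹ = 7 * e := by field_simp
            linarith
    have hs : Summable (fun k : ℕ => 4 * (1 / ((k + 1 : ℕ) : ℝ) ^ 2)) :=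
      ((summable_nat_add_iff 1).2 (Real.summable_one_div_nat_pow.2 (by norm_num : 1 < 2))).mul_left 4
    exact ne_top_of_le_ne_top hs.tsum_ofReal_ne_top (ENNReal.tsum_le_tsum hb)
  have hm : ∀ k, Measurable fun ω => ENNReal.ofReal |A k ω - A (k + 1) ω| := fun k =>
    ((hAm k).sub (hAm (k + 1))).abs.ennreal_ofReal
  rw [← lintegral_tsum fun k => (hm k).aemeasurable] at hsum
  filter_upwards [ae_lt_top (Measurable.ennreal_tsum hm) hsum] with ω hω
  have hs : Summable fun k => |A k ω - A (k + 1) ω| := by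
    have := ENNReal.summable_toReal hω.ne
    refine this.congr fun k => ?_
    rw [ENNReal.toReal_ofReal (abs_nonneg _)]
  exact cauchySeq_tendsto_of_complete (cauchySeq_of_summable_dist (f := fun k => A k ω)
    (by simpa [Real.dist_eq] using hs))

lemma ae_conv (hY : ∀ n, Measurable (Y n)) (hex : Exchangeable P Y) (c : ℤ) :
    ∀ᵐ ω ∂P, ∃ l : ℝ, Tendsto (fun n : ℕ => cnt c (fun i => Y i ω) n / n) atTop (𝓝 l) := by
  filter_upwards [ae_cube hY hex c] with ω ⟨l, hl⟩
  refine ⟨l, tendsto_div_of_monotone_of_exists_subseq_tendsto_div _ l (cnt_mono _ _) ?_⟩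
  intro a ha
  refine ⟨fun k => (k + 1) ^ 3, ?_, ?_, hl⟩
  · have h1 : Tendsto (fun k : ℕ => (1 + 1 / ((k : ℝ) + 1)) ^ 3) atTop (𝓝 ((1 + 0) ^ 3)) :=
      (tendsto_const_nhds.add tendsto_one_div_add_atTop_nhds_zero_nat).pow 3
    have h2 := h1.eventually (gt_mem_nhds (show ((1 : ℝ) + 0) ^ 3 < a by simpa using ha))
    filter_upwards [h2] with k hk
    push_cast
    have hp : (0 : ℝ) < (k : ℝ) + 1 := by positivity
    have : ((k : ℝ) + 1 + 1) ^ 3 = (1 + 1 / ((k : ℝ) + 1)) ^ 3 * (k + 1) ^ 3 := by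
      rw [← mul_pow]; congr 1; field_simp
    rw [this]
    gcongr
  · exact (tendsto_pow_atTop (by norm_num)).comp (tendsto_add_atTop_nat 1)

/-- Sequences with asymptotic frequency of `c` equal to zero. -/
def zeroSet (c : ℤ) : Set (ℕ → ℤ) := {y | Tendsto (fun n : ℕ => cnt c y n / n) atTop (𝓝 0)}

lemma zeroSet_meas (c : ℤ) : MeasurableSet (zeroSet c) :=
  measurableSet_tendsto _ fun n => (cnt_meas c n).div_const _

lemma cnt_swap (c : ℤ) (y : ℕ → ℤ) (a b n : ℕ) (ha : a < n) (hb : b < n) :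
    cnt c (fun k => y (Equiv.swap a b k)) n = cnt c y n := by
  unfold cnt
  refine Finset.sum_equiv (Equiv.swap a b) ?_ (fun i _ => rfl)
  intro i
  simp only [Finset.mem_range]
  rcases eq_or_ne i a with rfl | h1
  · simp [ha, hb]
  rcases eq_or_ne i b with rfl | h2
  · simp [ha, hb]
  rw [Equiv.swap_apply_of_ne_of_ne h1 h2]

lemma zeroSet_swap (c : ℤ) (y : ℕ → ℤ) (a b : ℕ) :
    (fun k => y (Equiv.swap a b k)) ∈ zeroSet c ↔ y ∈ zeroSet c := by
  unfold zeroSet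
  simp only [Set.mem_ofPred_eq]
  apply tendsto_congr'
  filter_upwards [eventually_gt_atTop a, eventually_gt_atTop b] with n h1 h2
  rw [cnt_swap c y a b n h1 h2]

lemma zero_null (hY : ∀ n, Measurable (Y n)) (hex : Exchangeable P Y) (c : ℤ) (k : ℕ) :
    P {ω | (fun n => Y n ω) ∈ zeroSet c ∧ Y k ω = c} = 0 := by
  have hYm : Measurable (fun ω => fun i => Y i ω) := measurable_pi_lambda _ hY
  have hset : ∀ j, MeasurableSet {y : ℕ → ℤ | y ∈ zeroSet c ∧ y j = c} := fun j =>
    (zeroSet_meas c).inter (show MeasurableSet ((fun y : ℕ → ℤ => y j) ⁻¹' {c}) from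
      measurable_pi_apply j (measurableSet_singleton c))
  set E : ℕ → Set Ω := fun j => {ω | (fun n => Y n ω) ∈ zeroSet c ∧ Y j ω = c} with hE
  have hEm : ∀ j, MeasurableSet (E j) := fun j => hYm (hset j)
  have heq : ∀ j, P (E j) = P (E 0) := by
    intro j
    have := exch_swap hY hex 0 j (hset 0)
    simp only [Set.mem_ofPred_eq, Equiv.swap_apply_left] at this
    rw [← this]
    congr 1
    ext ω
    simp only [hE, Set.mem_ofPred_eq]
    rw [zeroSet_swap c (fun n => Y n ω) 0 j]
  set Z : Set Ω := {ω | (fun n => Y n ω) ∈ zeroSet c} with hZ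
  have hZm : MeasurableSet Z := hYm (zeroSet_meas c)
  have hint : ∀ n : ℕ, 0 < n → ∫ ω, Z.indicator (fun ω => cnt c (fun i => Y i ω) n / n) ω ∂P
      = P.real (E 0) := by
    intro n hn
    have h1 : ∀ ω, Z.indicator (fun ω => cnt c (fun i => Y i ω) n / n) ω =
        (∑ j ∈ Finset.range n, (E j).indicator (fun _ => (1 : ℝ)) ω) * (1 / n) := by
      intro ω
      by_cases h : ω ∈ Z
      · rw [Set.indicator_of_mem h, cnt, div_eq_mul_one_div]
        congr 1
        apply Finset.sum_congr rfl
        intro j _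
        have h' : (fun n => Y n ω) ∈ zeroSet c := h
        simp [ind, Set.indicator, hE, h']
      · rw [Set.indicator_of_notMem h]
        have h' : (fun n => Y n ω) ∉ zeroSet c := h
        simp [Set.indicator, hE, h']
    simp_rw [h1]
    rw [integral_mul_const, integral_finsetSum _ fun j _ =>
      (integrable_const (1 : ℝ)).indicator (hEm j)]
    have h2 : ∀ j, ∫ ω, (E j).indicator (fun _ => (1 : ℝ)) ω ∂P = P.real (E 0) := by
      intro j
      rw [integral_indicator_const _ (hEm j)]
      simp [Measure.real, heq j]
    simp_rw [h2]
    simp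
    field_simp
  have hlim : Tendsto (fun n : ℕ => ∫ ω, Z.indicator (fun ω => cnt c (fun i => Y i ω) n / n) ω ∂P)
      atTop (𝓝 (∫ ω, (0 : ℝ) ∂P)) := by
    refine tendsto_integral_of_dominated_convergence (fun _ => 1) ?_ (integrable_const _) ?_ ?_
    · intro n
      exact ((((cnt_meas c n).comp hYm).div_const _).indicator hZm).aestronglyMeasurable
    · intro n
      refine ae_of_all _ fun ω => ?_
      by_cases h : ω ∈ Z
      · rw [Set.indicator_of_mem h, Real.norm_of_nonneg (cnt_div_nonneg _ _ _)]
        exact cnt_div_le _ _ _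
      · rw [Set.indicator_of_notMem h]; simp
    · refine ae_of_all _ fun ω => ?_
      by_cases h : ω ∈ Z
      · simp_rw [Set.indicator_of_mem h]
        exact h
      · simp_rw [Set.indicator_of_notMem h]
        exact tendsto_const_nhds
  have hlim2 : Tendsto (fun n : ℕ => ∫ ω, Z.indicator (fun ω => cnt c (fun i => Y i ω) n / n) ω ∂P)
      atTop (𝓝 (P.real (E 0))) := by
    apply tendsto_const_nhds.congr'
    filter_upwards [eventually_gt_atTop 0] with n hn
    exact (hint n hn).symm
  have h0 := tendsto_nhds_unique hlim2 hlim
  rw [integral_zero, measureReal_eq_zero_iff] at h0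
  exact (heq k).trans h0

lemma exch_core (hY : ∀ n, Measurable (Y n)) (hex : Exchangeable P Y) (c : ℤ) :
    ∀ᵐ ω ∂P, ∃ l : ℝ, Tendsto (fun n : ℕ => cnt c (fun i => Y i ω) n / n) atTop (𝓝 l) ∧
      ((∃ k, Y k ω = c) → 0 < l) := by
  have h0 : ∀ᵐ ω ∂P, ∀ k, ¬ ((fun n => Y n ω) ∈ zeroSet c ∧ Y k ω = c) := by
    rw [ae_all_iff]
    intro k
    rw [ae_iff]
    simpa using zero_null hY hex c k
  filter_upwards [ae_conv hY hex c, h0] with ω ⟨l, hl⟩ hω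
  refine ⟨l, hl, ?_⟩
  rintro ⟨k, hk⟩
  have hl0 : 0 ≤ l := ge_of_tendsto' hl fun n => cnt_div_nonneg _ _ _
  rcases hl0.eq_or_lt with rfl | h
  · exact absurd ⟨hl, hk⟩ (hω k)
  · exact h
end L2
/-- Left endpoint of the interval attached to a (reversed) word. -/
def aR (L : Word → ℝ) : Word → ℝ
  | [] => 0
  | b :: r => aR L r + if b then L (r.reverse ++ [false]) else 0

/-- Reversed digits. -/
noncomputable def dR (L : Word → ℝ) (x : ℝ) : ℕ → Word
  | 0 => []
  | k + 1 => decide (aR L (dR L x k) + L ((dR L x k).reverse ++ [false]) ≤ x) :: dR L x k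

noncomputable def digSeq (L : Word → ℝ) (x : ℝ) (k : ℕ) : Bool :=
  decide (aR L (dR L x k) + L ((dR L x k).reverse ++ [false]) ≤ x)

lemma prefix_digSeq (L : Word → ℝ) (x : ℝ) (k : ℕ) :
    prefixSeq (digSeq L x) k = (dR L x k).reverse := by
  induction k with
  | zero => simp [prefixSeq, dR]
  | succ k ih =>
    rw [prefixSeq, List.ofFn_succ_last]
    simp only [dR, List.reverse_cons]
    have ih' : (List.ofFn fun i : Fin k => digSeq L x i) = (dR L x k).reverse := ih
    rw [← ih']
    congr 1
    rw [ih']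
    rfl

lemma dR_iff (L : Word → ℝ) (h0 : ∀ u, 0 ≤ L u) (h1 : L [] = 1)
    (hadd : ∀ u, L u = L (u ++ [false]) + L (u ++ [true])) (x : ℝ) (hx : x ∈ Set.Ico (0 : ℝ) 1)
    (r : Word) : dR L x r.length = r ↔ x ∈ Set.Ico (aR L r) (aR L r + L r.reverse) := by
  induction r with
  | nil => simpa [dR, aR, h1] using hx
  | cons b r ih =>
    simp only [List.length_cons, dR, List.cons.injEq]
    rw [and_comm]
    have e : (dR L x r.length = r ∧
        decide (aR L (dR L x r.length) + L ((dR L x r.length).reverse ++ [false]) ≤ x) = b) ↔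
        (dR L x r.length = r ∧ decide (aR L r + L (r.reverse ++ [false]) ≤ x) = b) := by
      constructor
      · rintro ⟨h, h'⟩
        rw [h] at h'
        exact ⟨h, h'⟩
      · rintro ⟨h, h'⟩
        refine ⟨h, ?_⟩
        rw [h]
        exact h'
    rw [e, ih]
    have ha := hadd r.reverse
    have hf := h0 (r.reverse ++ [false])
    have ht := h0 (r.reverse ++ [true])
    cases b
    · simp only [Set.mem_Ico, aR, List.reverse_cons, decide_eq_false_iff_not, not_le]
      simp
      intro _ _
      linarith
    · simp only [Set.mem_Ico, aR, List.reverse_cons, decide_eq_true_eq]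
      simp
      constructor
      · rintro ⟨⟨_, _⟩, _⟩
        constructor <;> linarith
      · rintro ⟨_, _⟩
        refine ⟨⟨?_, ?_⟩, ?_⟩ <;> linarith

lemma aR_bounds (L : Word → ℝ) (h0 : ∀ u, 0 ≤ L u) (h1 : L [] = 1)
    (hadd : ∀ u, L u = L (u ++ [false]) + L (u ++ [true])) (r : Word) :
    0 ≤ aR L r ∧ aR L r + L r.reverse ≤ 1 := by
  induction r with
  | nil => simp [aR, h1]
  | cons b r ih =>
    have ha := hadd r.reverse
    have hf := h0 (r.reverse ++ [false])
    have ht := h0 (r.reverse ++ [true])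
    cases b
    · simp [aR]
      constructor <;> linarith
    · simp [aR]
      constructor <;> linarith

lemma dR_meas (L : Word → ℝ) (k : ℕ) : ∀ r : Word, MeasurableSet {x : ℝ | dR L x k = r} := by
  induction k with
  | zero => intro r; simp [dR]
  | succ k ih =>
    intro r
    cases r with
    | nil => simp [dR]
    | cons b r =>
      have : {x : ℝ | dR L x (k + 1) = b :: r} = {x : ℝ | dR L x k = r} ∩
          {x : ℝ | decide (aR L r + L (r.reverse ++ [false]) ≤ x) = b} := by
        ext x
        simp only [Set.mem_inter_iff, Set.mem_ofPred_eq, dR, List.cons.injEq]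
        constructor
        · rintro ⟨h, h'⟩
          rw [h'] at h
          exact ⟨h', h⟩
        · rintro ⟨h, h'⟩
          refine ⟨?_, h⟩
          rw [h]
          exact h'
      rw [this]
      refine (ih r).inter ?_
      cases b
      · simp only [decide_eq_false_iff_not, not_le]
        exact measurableSet_Iio
      · simp only [decide_eq_true_eq]
        exact measurableSet_Ici

lemma digSeq_meas (L : Word → ℝ) : Measurable (digSeq L) := by
  refine measurable_pi_lambda _ fun k => ?_
  apply measurable_to_bool
  have : (fun x => digSeq L x k) ⁻¹' {true} = ⋃ r : Word, {x : ℝ | dR L x (k + 1) = true :: r} := by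
    ext x
    simp [dR, digSeq]
  rw [this]
  exact MeasurableSet.iUnion fun r => dR_meas L _ _

lemma prefix_meas (u : Word) : MeasurableSet (cyl u) := by
  have : cyl u = ⋂ i : Fin u.length, {v : BSeq | v i = u[i]} := by
    ext v
    simp only [cyl, prefixSeq, Set.mem_ofPred_eq, Set.mem_iInter]
    constructor
    · intro h i
      have h2 : u[i]? = (List.ofFn fun i : Fin u.length => v i)[i]? := by rw [h]
      simpa using h2.symm
    · intro h
      apply List.ext_getElem
      · simp
      · intro i h1 h2
        simpa using h ⟨i, h2⟩
  rw [this]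
  exact MeasurableSet.iInter fun i => (show MeasurableSet ((fun v : BSeq => v i) ⁻¹' {u[i]}) from
    measurable_pi_apply _ (measurableSet_singleton _))

lemma exists_measure (L : Word → ℝ) (h0 : ∀ u, 0 ≤ L u) (h1 : L [] = 1)
    (hadd : ∀ u, L u = L (u ++ [false]) + L (u ++ [true])) :
    ∃ μ : Measure BSeq, IsProbabilityMeasure μ ∧ ∀ u, μ (cyl u) = ENNReal.ofReal (L u) := by
  have key : ∀ u, (Measure.map (digSeq L) (volume.restrict (Set.Ico (0 : ℝ) 1))) (cyl u)
      = ENNReal.ofReal (L u) := by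
    intro u
    rw [Measure.map_apply (digSeq_meas L) (prefix_meas u),
      Measure.restrict_apply (digSeq_meas L (prefix_meas u))]
    have : digSeq L ⁻¹' cyl u ∩ Set.Ico (0 : ℝ) 1 =
        Set.Ico (aR L u.reverse) (aR L u.reverse + L u) := by
      ext x
      have hb := aR_bounds L h0 h1 hadd u.reverse
      have hi := dR_iff L h0 h1 hadd x
      simp only [Set.mem_inter_iff, Set.mem_preimage, cyl, Set.mem_ofPred_eq, prefix_digSeq]
      rw [List.reverse_eq_iff]
      rw [List.reverse_reverse] at hb
      constructor
      · rintro ⟨h, hx⟩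
        have := hi hx u.reverse
        rw [List.length_reverse, List.reverse_reverse] at this
        exact this.1 h
      · intro h
        have hx : x ∈ Set.Ico (0 : ℝ) 1 := ⟨hb.1.trans h.1, h.2.trans_le hb.2⟩
        have := hi hx u.reverse
        rw [List.length_reverse, List.reverse_reverse] at this
        exact ⟨this.2 h, hx⟩
    rw [this, Real.volume_Ico]
    congr 1
    ring
  refine ⟨_, ⟨?_⟩, key⟩
  have h := key []
  have hu : cyl [] = Set.univ := by ext v; simp [cyl, prefixSeq]
  rw [hu, h1] at h
  simpa using h
/-- Good paths. -/
def GoodPath (x : ℕ → Finset Word) : Prop :=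
  (∀ n, IsBinTree (x n) ∧ (x n).card = n + 1 ∧ x n ⊆ x (n + 1)) ∧ ∀ w : Word, ∃ n, w ∈ x n

lemma tree_pfx {x : Finset Word} (hx : IsBinTree x) (v : Word) :
    ∀ w : Word, v ++ w ∈ x → v ∈ x := by
  intro w
  induction w using List.reverseRecOn with
  | nil => simp
  | append_singleton w b ih =>
    intro h
    apply ih
    have := hx _ h (by simp)
    rwa [← List.append_assoc, List.dropLast_concat] at this

lemma tree_pfx' {x : Finset Word} (hx : IsBinTree x) {v w : Word} (hw : w ∈ x)
    (h : v <+: w) : v ∈ x := by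
  obtain ⟨t, rfl⟩ := h
  exact tree_pfx hx v t hw

lemma new_node {x : ℕ → Finset Word} (hx : GoodPath x) (n : ℕ) :
    ∃ w, w ∉ x n ∧ insert w (x n) = x (n + 1) := by
  obtain ⟨_, h2, h3⟩ := hx.1 n
  obtain ⟨_, h2', _⟩ := hx.1 (n + 1)
  exact Finset.exists_eq_insert_iff.2 ⟨h3, by omega⟩

lemma subCard_insert {x : Finset Word} {w : Word} (hw : w ∉ x) (v : Word) :
    subCard (insert w x) v = subCard x v + if v <+: w then 1 else 0 := by
  unfold subCard
  rw [Finset.filter_insert]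
  split_ifs with h
  · rw [Finset.card_insert_of_notMem (by simp [hw])]
  · simp

lemma prefix_excl {u w : Word} {b b' : Bool} (h : u ++ [b] <+: w) (h' : u ++ [b'] <+: w) :
    b = b' := by
  have h1 := List.prefix_of_prefix_length_le h h' (by simp)
  have h2 := h1.eq_of_length (by simp)
  simpa using h2

/-- The value of the increment coding the direction `b`. -/
def code (b : Bool) : ℤ := if b then 1 else -1

lemma entry_mem {x : ℕ → Finset Word} (hx : GoodPath x) (u : Word) : u ∈ x (entryTime x u) :=
  Nat.sInf_mem (s := {n | u ∈ x n}) (hx.2 u)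

lemma subCard_entry {x : ℕ → Finset Word} (hx : GoodPath x) (u : Word) (b : Bool) :
    subCard (x (entryTime x u)) (u ++ [b]) = 0 := by
  have hu := entry_mem hx u
  have hnot : u ++ [b] ∉ x (entryTime x u) := by
    intro hb
    rcases h : entryTime x u with _ | t
    · rw [h] at hu hb
      have hc := (hx.1 0).2.1
      have := Finset.card_le_one.1 (le_of_eq hc) _ hu _ hb
      simp at this
    · have hut : u ∉ x t := fun hm => by
        have : t ∉ {n | u ∈ x n} := Nat.notMem_of_lt_sInf (by
          change t < entryTime x u
          omega)
        exact this hm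
      rw [h] at hu hb
      obtain ⟨w, hw, hins⟩ := new_node hx t
      rw [← hins, Finset.mem_insert] at hu hb
      have hu' : u = w := hu.resolve_right hut
      rcases hb with hb | hb
      · rw [← hu'] at hb
        simp at hb
      · exact hut (tree_pfx (hx.1 t).1 u _ hb)
  unfold subCard
  rw [Finset.card_eq_zero, Finset.filter_eq_empty_iff]
  intro w hw hp
  exact hnot (tree_pfx' (hx.1 _).1 hw hp)

lemma locInc_eq {x : ℕ → Finset Word} (hx : GoodPath x) (u : Word) (b : Bool) (n : ℕ) :
    (subCard (x (entryTime x u + n + 1)) (u ++ [b]) : ℝ) =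
      subCard (x (entryTime x u + n)) (u ++ [b]) + ind (code b) (locInc x u n) := by
  obtain ⟨w, hw, hins⟩ := new_node hx (entryTime x u + n)
  unfold locInc
  rw [← hins]
  simp only [subCard_insert hw]
  by_cases ht : u ++ [true] <+: w
  · have hf : ¬ u ++ [false] <+: w := fun h => by simpa using prefix_excl ht h
    cases b <;> simp [ht, hf, ind, code]
  · by_cases hf : u ++ [false] <+: w
    · cases b <;> simp [ht, hf, ind, code]
    · cases b <;> simp [ht, hf, ind, code]

lemma subCard_cnt {x : ℕ → Finset Word} (hx : GoodPath x) (u : Word) (b : Bool) (n : ℕ) :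
    (subCard (x (entryTime x u + n)) (u ++ [b]) : ℝ) = cnt (code b) (locInc x u) n := by
  induction n with
  | zero => simp [subCard_entry hx, cnt]
  | succ n ih =>
    rw [← add_assoc, locInc_eq hx, ih, cnt, cnt, Finset.sum_range_succ]

lemma exists_inc {x : ℕ → Finset Word} (hx : GoodPath x) (u : Word) (b : Bool) :
    ∃ k, locInc x u k = code b := by
  by_contra! h
  have hm : ∀ n, u ++ [b] ∉ x (entryTime x u + n) := by
    intro n hn
    have h1 := subCard_cnt hx u b n
    have h2 : cnt (code b) (locInc x u) n = 0 := by
      unfold cnt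
      exact Finset.sum_eq_zero fun i _ => by simp [ind, h i]
    rw [h2, Nat.cast_eq_zero, subCard, Finset.card_eq_zero, Finset.filter_eq_empty_iff] at h1
    exact h1 hn (List.prefix_refl _)
  obtain ⟨n, hn⟩ := hx.2 (u ++ [b])
  have hmono : Monotone x := monotone_nat_of_le_succ fun n => (hx.1 n).2.2
  exact hm n (hmono (Nat.le_add_left _ _) hn)

lemma stf_tendsto {x : ℕ → Finset Word} (hx : GoodPath x) (u : Word) (b : Bool) {l : ℝ}
    (h : Tendsto (fun n : ℕ => cnt (code b) (locInc x u) n / n) atTop (𝓝 l)) :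
    Tendsto (fun n => stf (x n) (u ++ [b])) atTop (𝓝 l) := by
  rw [← tendsto_add_atTop_iff_nat (entryTime x u)]
  set τ := entryTime x u with hτ
  have h1 : Tendsto (fun n : ℕ => (n : ℝ) / ((n : ℝ) + (τ + 1))) atTop (𝓝 1) :=
    tendsto_natCast_div_add_atTop _
  have h2 := h.mul h1
  rw [mul_one] at h2
  apply h2.congr'
  filter_upwards [eventually_gt_atTop 0] with n hn
  unfold stf
  rw [(hx.1 _).2.1, add_comm n τ, hτ, subCard_cnt hx, ← hτ]
  have : (n : ℝ) ≠ 0 := by exact_mod_cast hn.ne'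
  push_cast
  field_simp
  ring

lemma stf_nil {x : ℕ → Finset Word} (hx : GoodPath x) (n : ℕ) : stf (x n) [] = 1 := by
  unfold stf subCard
  rw [Finset.filter_true_of_mem (fun w _ => ⟨w, rfl⟩)]
  rw [(hx.1 n).2.1]
  exact div_self (by positivity)

lemma subCard_split (x : Finset Word) (u : Word) :
    subCard x u = (if u ∈ x then 1 else 0) + subCard x (u ++ [false]) + subCard x (u ++ [true]) := by
  induction x using Finset.induction_on with
  | empty => simp [subCard]
  | insert w x hw ih =>
    rw [subCard_insert hw, subCard_insert hw, subCard_insert hw, ih]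
    have e : (if u ∈ insert w x then 1 else 0) = (if u ∈ x then 1 else 0) + (if u = w then 1 else 0) := by
      by_cases h : u = w
      · subst h; simp [hw]
      · simp [h]
    have e2 : (if u <+: w then 1 else 0) = (if u = w then 1 else 0) +
        (if u ++ [false] <+: w then 1 else 0) + (if u ++ [true] <+: w then 1 else 0) := by
      by_cases h : u <+: w
      · obtain ⟨t, rfl⟩ := h
        simp only [List.prefix_append_right_inj, List.prefix_append]
        cases t with
        | nil => simp
        | cons b t => cases b <;> simp
      · have h1 : u ≠ w := by rintro rfl; simp at h
        have h2 : ∀ b, ¬ u ++ [b] <+: w := fun b hb => h ((List.prefix_append _ _).trans hb)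
        simp [h, h1, h2]
    rw [e, e2]
    ring

lemma lim_add {x : ℕ → Finset Word} (hx : GoodPath x) (u : Word) {l l0 l1 : ℝ}
    (h : Tendsto (fun n => stf (x n) u) atTop (𝓝 l))
    (h0 : Tendsto (fun n => stf (x n) (u ++ [false])) atTop (𝓝 l0))
    (h1 : Tendsto (fun n => stf (x n) (u ++ [true])) atTop (𝓝 l1)) : l = l0 + l1 := by
  have hz : Tendsto (fun n => (if u ∈ x n then (1 : ℝ) else 0) * (1 / ((n : ℝ) + 1))) atTop (𝓝 0) := by
    refine squeeze_zero (fun n => ?_) (fun n => ?_) tendsto_one_div_add_atTop_nhds_zero_nat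
    · split_ifs <;> positivity
    · have : (0 : ℝ) ≤ 1 / ((n : ℝ) + 1) := by positivity
      split_ifs <;> simp
      positivity
  have h2 := (hz.add h0).add h1
  rw [zero_add] at h2
  refine tendsto_nhds_unique h (h2.congr fun n => ?_)
  unfold stf
  rw [subCard_split (x n) u, (hx.1 n).2.1]
  push_cast
  ring

section meas
variable {Ω : Type*} [MeasurableSpace Ω] {X : ℕ → Ω → Finset Word}

lemma meas_comp (hX : ∀ n, Measurable (X n)) {β : Type*} [MeasurableSpace β]
    (f : Finset Word → β) (n : ℕ) : Measurable (fun ω => f (X n ω)) :=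
  (show Measurable f from fun _ _ => trivial).comp (hX n)

lemma mem_meas (hX : ∀ n, Measurable (X n)) (w : Word) (n : ℕ) :
    MeasurableSet {ω | w ∈ X n ω} :=
  hX n (show MeasurableSet {x : Finset Word | w ∈ x} from trivial)

lemma entry_meas (hX : ∀ n, Measurable (X n)) (w : Word) :
    Measurable (fun ω => entryTime (fun m => X m ω) w) := by
  apply measurable_to_countable'
  intro m
  have : (fun ω => entryTime (fun m => X m ω) w) ⁻¹' {m} =
      ({ω | w ∈ X m ω} ∩ ⋂ k : ℕ, ⋂ _ : k < m, {ω | w ∈ X k ω}ᶜ) ∪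
      (if m = 0 then ⋂ k : ℕ, {ω | w ∈ X k ω}ᶜ else ∅) := by
    ext ω
    simp only [Set.mem_preimage, Set.mem_singleton_iff, Set.mem_union, Set.mem_inter_iff,
      Set.mem_ofPred_eq, Set.mem_iInter, Set.mem_compl_iff]
    unfold entryTime
    constructor
    · rintro rfl
      by_cases hne : {n | w ∈ X n ω}.Nonempty
      · left
        exact ⟨Nat.sInf_mem hne, fun k hk => Nat.notMem_of_lt_sInf hk⟩
      · right
        rw [Set.not_nonempty_iff_eq_empty] at hne
        rw [hne]
        simp only [Nat.sInf_empty, if_true, Set.mem_iInter]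
        intro k hk
        have : k ∈ {n | w ∈ X n ω} := hk
        rw [hne] at this
        exact this
    · rintro (⟨h1, h2⟩ | h)
      · apply le_antisymm
        · exact Nat.sInf_le h1
        · by_contra! hlt
          exact h2 _ hlt (Nat.sInf_mem (s := {n | w ∈ X n ω}) ⟨m, h1⟩)
      · split_ifs at h with hm
        · simp only [Set.mem_iInter, Set.mem_compl_iff, Set.mem_ofPred_eq] at h
          have : {n | w ∈ X n ω} = ∅ := by ext k; simp [h k]
          rw [this, hm]; simp
        · simp at h
  rw [this]
  refine MeasurableSet.union ?_ ?_
  · exact (mem_meas hX w m).inter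
      (MeasurableSet.iInter fun k => MeasurableSet.iInter fun _ => (mem_meas hX w k).compl)
  · split_ifs
    · exact MeasurableSet.iInter fun k => (mem_meas hX w k).compl
    · exact MeasurableSet.empty

lemma locInc_meas (hX : ∀ n, Measurable (X n)) (u : Word) (n : ℕ) :
    Measurable (fun ω => locInc (fun m => X m ω) u n) := by
  have hs : ∀ (k : ℕ) (v : Word),
      Measurable (fun ω => subCard (X (entryTime (fun m => X m ω) u + k) ω) v) := by
    intro k v
    have hf : Measurable (fun p : Ω × ℕ => subCard (X (p.2 + k) p.1) v) :=
      measurable_from_prod_countable_left fun m => meas_comp hX (fun x => subCard x v) (m + k)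
    exact hf.comp (measurable_id.prodMk (entry_meas hX u))
  unfold locInc
  refine Measurable.ite (measurableSet_lt (hs n _) (hs (n + 1) _)) measurable_const ?_
  exact Measurable.ite (measurableSet_lt (hs n _) (hs (n + 1) _)) measurable_const measurable_const
end meas
/-- If `X = (X_n)` is a random sequence of binary trees growing by one node at a time and
exhausting `V` (here `X n` has `n+1` nodes, playing the role of the paper's `X_{n+1}`),
and `X` is locally exchangeable, then there is a random Borel probability measure `M` on
`V_∞` such that a.s. `t(X_n,u) → M(B_u)` for every `u ∈ V`, and a.s. `M` has full
support. -/
theorem stmt14 {Ω : Type*} [MeasurableSpace Ω] (P : Measure Ω) [IsProbabilityMeasure P]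
    (X : ℕ → Ω → Finset Word) (hXmeas : ∀ n, Measurable (X n))
    (hpath : ∀ᵐ ω ∂P,
      (∀ n, IsBinTree (X n ω) ∧ (X n ω).card = n + 1 ∧ X n ω ⊆ X (n + 1) ω) ∧
      ∀ w : Word, ∃ n, w ∈ X n ω)
    (hexch : ∀ u : Word, Exchangeable P (fun n ω => locInc (fun m => X m ω) u n)) :
    ∃ M : Ω → Measure BSeq,
      (∀ ω, IsProbabilityMeasure (M ω)) ∧
      (∀ u : Word, Measurable (fun ω => M ω (cyl u))) ∧
      ∀ᵐ ω ∂P,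
        (∀ u : Word, Tendsto (fun n => stf (X n ω) u) atTop (𝓝 ((M ω (cyl u)).toReal))) ∧
        (∀ u : Word, 0 < M ω (cyl u)) := by



  classical
  have hlim : ∀ᵐ ω ∂P, GoodPath (fun m => X m ω) ∧
      ∀ u : Word, ∃ l : ℝ, 0 < l ∧ Tendsto (fun n => stf (X n ω) u) atTop (𝓝 l) := by
    have hall : ∀ᵐ ω ∂P, ∀ (u : Word) (b : Bool), ∃ l : ℝ,
        Tendsto (fun n : ℕ => cnt (code b) (fun i => locInc (fun m => X m ω) u i) n / n)
          atTop (𝓝 l) ∧ ((∃ k, locInc (fun m => X m ω) u k = code b) → 0 < l) := by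
      rw [ae_all_iff]
      intro u
      rw [ae_all_iff]
      intro b
      exact exch_core (fun n => locInc_meas hXmeas u n) (hexch u) (code b)
    filter_upwards [hpath, hall] with ω hp ha
    have hg : GoodPath (fun m => X m ω) := hp
    refine ⟨hg, fun u => ?_⟩
    induction u using List.reverseRecOn with
    | nil =>
      refine ⟨1, one_pos, ?_⟩
      exact tendsto_const_nhds.congr fun n => (stf_nil hg n).symm
    | append_singleton u b _ =>
      obtain ⟨l, hl, hpos⟩ := ha u b
      exact ⟨l, hpos (exists_inc hg u b), stf_tendsto hg u b hl⟩
  set L : Ω → Word → ℝ := fun ω u => limsup (fun n => stf (X n ω) u) atTop with hL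
  have hLm : ∀ u, Measurable (fun ω => L ω u) := fun u =>
    Measurable.limsup fun n => meas_comp hXmeas (fun x => stf x u) n
  set G : Set Ω := {ω | (∀ u, 0 ≤ L ω u) ∧ L ω [] = 1 ∧
    ∀ u, L ω u = L ω (u ++ [false]) + L ω (u ++ [true])} with hG
  have hGm : MeasurableSet G := by
    have e : G = (⋂ u, {ω | 0 ≤ L ω u}) ∩ ({ω | L ω [] = 1} ∩
        ⋂ u, {ω | L ω u = L ω (u ++ [false]) + L ω (u ++ [true])}) := by
      ext ω
      simp [hG]
    rw [e]
    refine (MeasurableSet.iInter fun u => measurableSet_le measurable_const (hLm u)).inter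
      ((measurableSet_eq_fun (hLm _) measurable_const).inter
      (MeasurableSet.iInter fun u => measurableSet_eq_fun (hLm _) ((hLm _).add (hLm _))))
  have hM : ∀ ω, ∃ μ : Measure BSeq, IsProbabilityMeasure μ ∧
      ∀ u, μ (cyl u) = if ω ∈ G then ENNReal.ofReal (L ω u)
        else Measure.dirac (fun _ => false) (cyl u) := by
    intro ω
    by_cases h : ω ∈ G
    · simp only [h, if_true]
      exact exists_measure (L ω) h.1 h.2.1 h.2.2
    · simp only [h, if_false]
      exact ⟨Measure.dirac (fun _ => false), inferInstance, fun _ => rfl⟩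
  choose M hMp hMc using hM
  refine ⟨M, hMp, fun u => ?_, ?_⟩
  · simp_rw [hMc]
    exact Measurable.ite hGm (hLm u).ennreal_ofReal measurable_const
  · filter_upwards [hlim] with ω ⟨hg, hl⟩
    choose l hpos hl using hl
    have hLl : ∀ u, L ω u = l u := fun u => (hl u).limsup_eq
    have hmem : ω ∈ G := by
      refine ⟨fun u => ?_, ?_, fun u => ?_⟩
      · rw [hLl]; exact (hpos u).le
      · rw [hLl]
        exact tendsto_nhds_unique (hl [])
          (tendsto_const_nhds.congr fun n => (stf_nil hg n).symm)
      · rw [hLl, hLl, hLl]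
        exact lim_add hg u (hl _) (hl _) (hl _)
    constructor
    · intro u
      rw [hMc, if_pos hmem, hLl, ENNReal.toReal_ofReal (hpos u).le]
      exact hl u
    · intro u
      rw [hMc, if_pos hmem, hLl]
      exact ENNReal.ofReal_pos.2 (hpos u)

end DMTCS
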